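/- For all real z, the imaginary part of the dilogarithm evaluated at e^{iz} equals twice the Lobachevsky function at z/2; that is, Im(Li₂(e^{iz})) = 2Λ(z/2), where Λ(θ) = -∫₀^θ log|2 sin t| dt. -/

import Mathlib

open Real

/-- The Lobachevsky function `Λ(θ) = -∫₀^θ log |2 sin t| dt`. -/
noncomputable def lobachevsky (θ : ℝ) : ℝ := -∫ t in (0:ℝ)..θ, Real.log |2 * Real.sin t|

/-- The dilogarithm `Li₂(x) = -∫₀^x log(1-t)/t dt`, computed along the segment from `0` to `x`,
i.e. `Li₂(x) = -∫₀¹ log(1 - x s)/s ds`, with the principal branch of the logarithm. -/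
noncomputable def dilog (x : ℂ) : ℂ := -∫ s in (0:ℝ)..1, Complex.log (1 - x * (s : ℂ)) / (s : ℂ)

open Filter Topology MeasureTheory

/-- The series `Li₂(x) = ∑ xⁿ / n²` on the closed unit disc. -/
theorem hasSum_dilog {x : ℂ} (hx : ‖x‖ ≤ 1) :
    HasSum (fun n : ℕ => x ^ (n + 1) / ((n : ℂ) + 1) ^ 2) (dilog x) := by
  let F : ℕ → ℝ → ℂ := fun n s => x ^ (n + 1) / ((n : ℂ) + 1) * (s : ℂ) ^ n
  have hF_int (n : ℕ) : Integrable (F n) (volume.restrict (Set.Ioc (0 : ℝ) 1)) := by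
    have hcont : Continuous (F n) := by fun_prop
    exact (hcont.integrableOn_Icc (a := 0) (b := 1)).mono_set Set.Ioc_subset_Icc_self
  have hnorm (n : ℕ) : ∫ s in Set.Ioc (0 : ℝ) 1, ‖F n s‖ = ‖x‖ ^ (n + 1) / ((n : ℝ) + 1) ^ 2 := by
    have hcongr : ∫ s in Set.Ioc (0 : ℝ) 1, ‖F n s‖ =
        ∫ s in Set.Ioc (0 : ℝ) 1, ‖x‖ ^ (n + 1) / ((n : ℝ) + 1) * s ^ n := by
      refine setIntegral_congr_fun measurableSet_Ioc fun s hs => ?_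
      have hn : ‖(n : ℂ) + 1‖ = (n : ℝ) + 1 := by exact_mod_cast Complex.norm_natCast (n + 1)
      simp [F, hn, abs_of_pos hs.1]
    rw [hcongr, ← intervalIntegral.integral_of_le zero_le_one, intervalIntegral.integral_const_mul,
      integral_pow]
    simp
    field_simp
  have hint (n : ℕ) : ∫ s in Set.Ioc (0 : ℝ) 1, F n s = x ^ (n + 1) / ((n : ℂ) + 1) ^ 2 := by
    have hpow : ∫ s in (0 : ℝ)..1, (s : ℂ) ^ n = 1 / ((n : ℂ) + 1) := by
      have h : ∫ s in (0 : ℝ)..1, ((s ^ n : ℝ) : ℂ) = ((∫ s in (0 : ℝ)..1, s ^ n : ℝ) : ℂ) :=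
        intervalIntegral.integral_ofReal
      rw [integral_pow] at h
      simpa using h
    rw [← intervalIntegral.integral_of_le zero_le_one, intervalIntegral.integral_const_mul, hpow]
    have := Nat.cast_add_one_ne_zero (R := ℂ) n
    field_simp
  have hsummable : Summable fun n : ℕ => ∫ s in Set.Ioc (0 : ℝ) 1, ‖F n s‖ := by
    simp_rw [hnorm]
    refine Summable.of_nonneg_of_le (fun n => by positivity) (fun n => ?_)
      ((summable_nat_add_iff 1).2 (Real.summable_one_div_nat_pow.2 one_lt_two))
    push_cast
    gcongr
    exact pow_le_one₀ (norm_nonneg x) hx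
  have hsum := hasSum_integral_of_summable_integral_norm hF_int hsummable
  simp_rw [hint] at hsum
  suffices hval : dilog x = ∫ s in Set.Ioc (0 : ℝ) 1, ∑' n, F n s by rwa [hval]
  rw [dilog, intervalIntegral.integral_of_le zero_le_one, ← integral_neg,
    integral_Ioc_eq_integral_Ioo, integral_Ioc_eq_integral_Ioo]
  refine setIntegral_congr_fun measurableSet_Ioo fun s hs => ?_
  have hs0 : (s : ℂ) ≠ 0 := by exact_mod_cast hs.1.ne'
  have hxs : ‖x * s‖ < 1 := by
    rw [norm_mul, Complex.norm_real, Real.norm_of_nonneg hs.1.le]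
    nlinarith [hs.1, hs.2]
  have hlog := (hasSum_nat_add_iff' 1).2 (Complex.hasSum_taylorSeries_neg_log hxs)
  have hdiv := hlog.div_const (s : ℂ)
  simp only [Finset.sum_range_one, Nat.cast_zero, div_zero, sub_zero] at hdiv
  change -(Complex.log (1 - x * s) / s) = ∑' n, F n s
  rw [← neg_div, ← hdiv.tsum_eq]
  refine tsum_congr fun n => ?_
  have := Nat.cast_add_one_ne_zero (R := ℂ) n
  simp only [F]
  push_cast
  field_simp
  ring

/-- Termwise integration of the Fourier series of `log ‖1 - r e^{it}‖`. -/
theorem hasSum_integral_log_norm_one_sub {r : ℝ} (hr0 : 0 ≤ r) (hr1 : r < 1) (z : ℝ) :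
    HasSum (fun n : ℕ => r ^ (n + 1) * Real.sin ((n + 1) * z) / ((n : ℝ) + 1) ^ 2)
      (-∫ t in (0 : ℝ)..z, Real.log ‖1 - r * Complex.exp (t * Complex.I)‖) := by
  have hterm (n : ℕ) : ∫ t in (0 : ℝ)..z, r ^ (n + 1) / ((n : ℝ) + 1) * Real.cos ((n + 1) * t) =
      r ^ (n + 1) * Real.sin ((n + 1) * z) / ((n : ℝ) + 1) ^ 2 := by
    have hn : (n : ℝ) + 1 ≠ 0 := by positivity
    rw [intervalIntegral.integral_const_mul,
      intervalIntegral.integral_comp_mul_left (fun u => Real.cos u) hn, integral_cos]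
    simp
    field_simp
  have hgeom : Summable fun n : ℕ => r ^ (n + 1) :=
    (summable_nat_add_iff 1).2 (summable_geometric_of_lt_one hr0 hr1)
  simp_rw [← hterm, ← intervalIntegral.integral_neg]
  refine intervalIntegral.hasSum_integral_of_dominated_convergence (fun n _ => r ^ (n + 1))
    (fun n => ?_) (fun n => ?_) ?_ ?_ ?_
  · exact Continuous.aestronglyMeasurable (by fun_prop)
  · refine Eventually.of_forall fun t _ => ?_
    rw [norm_mul, Real.norm_of_nonneg (by positivity)]
    have hle : r ^ (n + 1) / ((n : ℝ) + 1) ≤ r ^ (n + 1) :=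
      div_le_self (by positivity) (by linarith [n.cast_nonneg (α := ℝ)])
    exact (mul_le_of_le_one_right (by positivity) (Real.abs_cos_le_one _)).trans hle
  · exact Eventually.of_forall fun _ _ => hgeom
  · exact intervalIntegrable_const
  · refine Eventually.of_forall fun t _ => ?_
    have hw : ‖(r : ℂ) * Complex.exp (t * Complex.I)‖ < 1 := by
      rwa [norm_mul, Complex.norm_exp_ofReal_mul_I, mul_one, Complex.norm_real,
        Real.norm_of_nonneg hr0]
    have hlog := Complex.hasSum_re
      ((hasSum_nat_add_iff' 1).2 (Complex.hasSum_taylorSeries_neg_log hw))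
    simp only [Finset.sum_range_one, Nat.cast_zero, div_zero, sub_zero, Complex.neg_re,
      Complex.log_re] at hlog
    refine hlog.congr_fun fun n => ?_
    have hexp : ((r : ℂ) * Complex.exp (t * Complex.I)) ^ (n + 1) / ((n + 1 : ℕ) : ℂ) =
        ((r ^ (n + 1) / ((n : ℝ) + 1) : ℝ) : ℂ) *
          Complex.exp ((((n : ℝ) + 1) * t : ℝ) * Complex.I) := by
      rw [mul_pow, ← Complex.exp_nat_mul]
      push_cast
      rw [← mul_assoc]
      ring
    rw [hexp, Complex.re_ofReal_mul, Complex.exp_ofReal_mul_I_re]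

theorem norm_one_sub_exp_mul_I (t : ℝ) :
    ‖1 - Complex.exp (t * Complex.I)‖ = |2 * Real.sin (t / 2)| := by
  rw [norm_sub_rev, mul_comm, Complex.norm_exp_I_mul_ofReal_sub_one, Real.norm_eq_abs]

theorem ae_sin_half_ne_zero : ∀ᵐ t : ℝ, Real.sin (t / 2) ≠ 0 := by
  have hcount : {t : ℝ | Real.sin (t / 2) = 0}.Countable := by
    refine (Set.countable_range fun n : ℤ => 2 * (n * π)).mono fun t ht => ?_
    obtain ⟨n, hn⟩ := Real.sin_eq_zero_iff.1 ht
    exact ⟨n, by simp only [hn]; ring⟩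
  simpa using hcount.ae_notMem volume

theorem intervalIntegrable_log_norm_one_sub_exp (a b : ℝ) :
    IntervalIntegrable (fun t : ℝ => Real.log ‖1 - Complex.exp (t * Complex.I)‖) volume a b := by
  simp_rw [norm_one_sub_exp_mul_I, ← Real.norm_eq_abs]
  refine MeromorphicOn.intervalIntegrable_log_norm (f := fun t => 2 * Real.sin (t / 2)) ?_
  intro t _
  have : AnalyticAt ℝ (fun t : ℝ => 2 * Real.sin (t / 2)) t := by fun_prop
  exact this.meromorphicAt

theorem abs_log_norm_one_sub_le {r : ℝ} (hr0 : 0 ≤ r) (hr1 : r ≤ 1) {u : ℂ} (hu : ‖u‖ = 1)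
    (hne : 1 - u ≠ 0) :
    |Real.log ‖1 - r * u‖| ≤ Real.log 2 + |Real.log ‖1 - u‖| := by
  have hru : ‖(r : ℂ) * u‖ = r := by rw [norm_mul, hu, mul_one, Complex.norm_of_nonneg hr0]
  have hpos : 0 < ‖1 - u‖ := norm_pos_iff.2 hne
  have hupper : ‖1 - r * u‖ ≤ 2 := by
    calc ‖1 - r * u‖ ≤ ‖(1 : ℂ)‖ + ‖(r : ℂ) * u‖ := norm_sub_le _ _
      _ ≤ 2 := by rw [hru, norm_one]; linarith
  have hdist : 1 - r ≤ ‖1 - r * u‖ := by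
    have := norm_sub_norm_le (1 : ℂ) (r * u)
    rwa [hru, norm_one] at this
  have hlower : ‖1 - u‖ ≤ 2 * ‖1 - r * u‖ := by
    have hsplit : 1 - u = (1 - r * u) - ((1 - r : ℝ) : ℂ) * u := by push_cast; ring
    have := norm_sub_le (1 - r * u) (((1 - r : ℝ) : ℂ) * u)
    rw [← hsplit, norm_mul, hu, mul_one, Complex.norm_of_nonneg (sub_nonneg.2 hr1)] at this
    linarith
  have hpos' : 0 < ‖1 - r * u‖ := by linarith
  have h1 := Real.log_le_log hpos' hupper
  have h2 := Real.log_le_log hpos hlower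
  rw [Real.log_mul two_ne_zero hpos'.ne'] at h2
  rw [abs_le]
  constructor <;> linarith [neg_abs_le (Real.log ‖1 - u‖), abs_nonneg (Real.log ‖1 - u‖)]

theorem tendsto_integral_log_norm_one_sub (z : ℝ) :
    Tendsto (fun r : ℝ => ∫ t in (0 : ℝ)..z, Real.log ‖1 - r * Complex.exp (t * Complex.I)‖)
      (𝓝[<] 1) (𝓝 (∫ t in (0 : ℝ)..z, Real.log ‖1 - Complex.exp (t * Complex.I)‖)) := by
  have hne : ∀ᵐ t : ℝ, 1 - Complex.exp (t * Complex.I) ≠ 0 := by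
    filter_upwards [ae_sin_half_ne_zero] with t ht
    rw [← norm_ne_zero_iff, norm_one_sub_exp_mul_I]
    simpa using ht
  refine intervalIntegral.tendsto_integral_filter_of_dominated_convergence
    (fun t => Real.log 2 + |Real.log ‖1 - Complex.exp (t * Complex.I)‖|) ?_ ?_ ?_ ?_
  · refine Eventually.of_forall fun r => Measurable.aestronglyMeasurable ?_
    exact Real.measurable_log.comp (Continuous.measurable (by fun_prop))
  · filter_upwards [Ioo_mem_nhdsLT (zero_lt_one (α := ℝ))] with r hr
    filter_upwards [hne] with t ht _
    exact abs_log_norm_one_sub_le hr.1.le hr.2.le (Complex.norm_exp_ofReal_mul_I t) ht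
  · exact intervalIntegrable_const.add (intervalIntegrable_log_norm_one_sub_exp 0 z).abs
  · filter_upwards [hne] with t ht _
    have hcont : ContinuousAt
        (fun r : ℝ => Real.log ‖1 - r * Complex.exp (t * Complex.I)‖) 1 := by
      refine ContinuousAt.log (Continuous.continuousAt (by fun_prop)) ?_
      simpa using ht
    simpa using hcont.tendsto.mono_left nhdsWithin_le_nhds

/-- `∑ sin (n z) / n²` is the Abel limit of the integrated series. -/
theorem tendsto_tsum_pow_mul_sin_div_sq (z : ℝ) :
    Tendsto (fun r : ℝ => ∑' n : ℕ, r ^ (n + 1) * Real.sin ((n + 1) * z) / ((n : ℝ) + 1) ^ 2)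
      (𝓝[<] 1) (𝓝 (∑' n : ℕ, Real.sin ((n + 1) * z) / ((n : ℝ) + 1) ^ 2)) := by
  refine tendsto_tsum_of_dominated_convergence (bound := fun n : ℕ => 1 / ((n : ℝ) + 1) ^ 2)
    ?_ (fun n => ?_) ?_
  · exact_mod_cast (summable_nat_add_iff 1).2 (Real.summable_one_div_nat_pow.2 one_lt_two)
  · have hcont : Continuous
        fun r : ℝ => r ^ (n + 1) * Real.sin ((n + 1) * z) / ((n : ℝ) + 1) ^ 2 := by fun_prop
    simpa using (hcont.tendsto 1).mono_left nhdsWithin_le_nhds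
  · filter_upwards [Ioo_mem_nhdsLT (zero_lt_one (α := ℝ))] with r hr n
    rw [norm_div, norm_mul, Real.norm_of_nonneg (pow_nonneg hr.1.le _),
      Real.norm_of_nonneg (by positivity : (0 : ℝ) ≤ ((n : ℝ) + 1) ^ 2)]
    gcongr
    exact mul_le_one₀ (pow_le_one₀ hr.1.le hr.2.le) (norm_nonneg _) (Real.abs_sin_le_one _)

theorem hasSum_im_dilog_exp (z : ℝ) :
    HasSum (fun n : ℕ => Real.sin ((n + 1) * z) / ((n : ℝ) + 1) ^ 2)
      (dilog (Complex.exp ((z : ℂ) * Complex.I))).im := by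
  have h := Complex.hasSum_im (hasSum_dilog (Complex.norm_exp_ofReal_mul_I z).le)
  refine h.congr_fun fun n => ?_
  have hexp : Complex.exp ((z : ℂ) * Complex.I) ^ (n + 1) / ((n : ℂ) + 1) ^ 2 =
      Complex.exp ((((n : ℝ) + 1) * z : ℝ) * Complex.I) / ((((n : ℝ) + 1) ^ 2 : ℝ) : ℂ) := by
    rw [← Complex.exp_nat_mul]
    push_cast
    rw [← mul_assoc]
  rw [hexp, Complex.div_ofReal_im, Complex.exp_ofReal_mul_I_im]

theorem integral_log_norm_one_sub_exp (z : ℝ) :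
    -∫ t in (0 : ℝ)..z, Real.log ‖1 - Complex.exp (t * Complex.I)‖ = 2 * lobachevsky (z / 2) := by
  simp_rw [norm_one_sub_exp_mul_I]
  rw [intervalIntegral.integral_comp_div (fun u => Real.log |2 * Real.sin u|) two_ne_zero,
    lobachevsky, zero_div, smul_eq_mul, mul_neg]

/-- `Im (Li₂(e^{iz})) = 2 Λ(z/2)` for all real `z`. -/
theorem im_dilog_exp (z : ℝ) :
    (dilog (Complex.exp ((z : ℂ) * Complex.I))).im = 2 * lobachevsky (z / 2) := by
  rw [← integral_log_norm_one_sub_exp, ← (hasSum_im_dilog_exp z).tsum_eq]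
  refine tendsto_nhds_unique (tendsto_tsum_pow_mul_sin_div_sq z) ?_
  refine (tendsto_integral_log_norm_one_sub z).neg.congr' ?_
  filter_upwards [Ioo_mem_nhdsLT (zero_lt_one (α := ℝ))] with r hr
  exact (hasSum_integral_log_norm_one_sub hr.1.le hr.2 z).tsum_eq.symm
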